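/- Suppose the ADMM iterates (x^k, λ^k)_{k∈ℕ} satisfy, for every k, the first-order optimality condition ∇f(x^{k+1}) + Aᵀλ^k + Aᵀρ^k A x^k + Q̄(x^{k+1} − x^k) = 0 and the multiplier update λ^{k+1} = λ^k + ρ^{k+1} A x^{k+1}; suppose Condition A holds (ρ^0 ⪯ ρ^k ⪯ ρ^{k+1} ⪯ ρ̄ for all k, with all ρ^k and ρ̄ diagonal positive definite), Condition B holds (Q̄ − Aᵀρ̄A is positive definite), and the Lagrangian L has a saddle point. Then the sequence (x^k) converges to an optimal solution of the constrained problem: there exists x̂ ∈ ℝ^{ND} with A x̂ = 0 and f(x̂) ≤ f(y) for every y ∈ ℝ^{ND} with A y = 0, such that x^k → x̂ as k → ∞. -/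

import Mathlib

open Matrix Filter

section Coercivity

variable {n : Type*} [Fintype n]

/-- A positive definite quadratic form on a finite-dimensional space is coercive. -/
theorem exists_pos_mul_norm_sq_le_of_posDef {M : Matrix n n ℝ} (hM : M.PosDef) :
    ∃ c > 0, ∀ v : n → ℝ, c * ‖v‖ ^ 2 ≤ v ⬝ᵥ M *ᵥ v := by
  have hcont : Continuous fun v : n → ℝ => v ⬝ᵥ M *ᵥ v := by fun_prop
  rcases (Metric.sphere (0 : n → ℝ) 1).eq_empty_or_nonempty with hS | hS
  · refine ⟨1, one_pos, fun v => ?_⟩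
    have hv : v = 0 := by
      by_contra hv
      have : ‖v‖⁻¹ • v ∈ Metric.sphere (0 : n → ℝ) 1 := by
        simp [norm_smul, hv]
      simp [hS] at this
    simp [hv]
  · obtain ⟨u, hu, hmin⟩ := (isCompact_sphere (0 : n → ℝ) 1).exists_isMinOn hS hcont.continuousOn
    have hu0 : u ≠ 0 := by
      rintro rfl
      simp at hu
    refine ⟨u ⬝ᵥ M *ᵥ u, by simpa using hM.dotProduct_mulVec_pos hu0, fun v => ?_⟩
    rcases eq_or_ne v 0 with rfl | hv
    · simp
    have hv' : 0 < ‖v‖ := norm_pos_iff.mpr hv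
    have hmem : ‖v‖⁻¹ • v ∈ Metric.sphere (0 : n → ℝ) 1 := by
      simp [norm_smul, hv]
    have h := isMinOn_iff.mp hmin _ hmem
    simp only [mulVec_smul, dotProduct_smul, smul_dotProduct, smul_eq_mul] at h
    calc (u ⬝ᵥ M *ᵥ u) * ‖v‖ ^ 2
        ≤ (‖v‖⁻¹ * (‖v‖⁻¹ * (v ⬝ᵥ M *ᵥ v))) * ‖v‖ ^ 2 := by gcongr
      _ = v ⬝ᵥ M *ᵥ v := by field_simp

theorem exists_pos_mul_norm_sq_le_sum {d : n → ℝ} (hd : ∀ i, 0 < d i) :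
    ∃ c > 0, ∀ v : n → ℝ, c * ‖v‖ ^ 2 ≤ ∑ i, d i * v i ^ 2 := by
  classical
  obtain ⟨c, hc, h⟩ := exists_pos_mul_norm_sq_le_of_posDef (PosDef.diagonal hd)
  refine ⟨c, hc, fun v => (h v).trans_eq (Finset.sum_congr rfl fun i _ => ?_)⟩
  rw [mulVec_diagonal]
  ring

end Coercivity

section Gradient

/-- The first-order characterization of convexity. -/
theorem ConvexOn.add_fderiv_sub_le {V : Type*} [NormedAddCommGroup V] [NormedSpace ℝ V]
    {f : V → ℝ} (hf : ConvexOn ℝ Set.univ f) {x : V} (hd : DifferentiableAt ℝ f x) (y : V) :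
    f x + fderiv ℝ f x (y - x) ≤ f y := by
  have hg : ConvexOn ℝ Set.univ (f ∘ AffineMap.lineMap (k := ℝ) x y) := by
    simpa using hf.comp_affineMap (AffineMap.lineMap (k := ℝ) x y)
  have hd' : HasFDerivAt f (fderiv ℝ f x) (AffineMap.lineMap (k := ℝ) x y 0) := by
    simpa using hd.hasFDerivAt
  have hder := hd'.comp_hasDerivAt (0 : ℝ) AffineMap.hasDerivAt_lineMap
  have h := hg.le_slope_of_hasDerivAt (Set.mem_univ _) (Set.mem_univ _) one_pos hder
  simp only [slope_def_field, Function.comp_apply, AffineMap.lineMap_apply_zero,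
    AffineMap.lineMap_apply_one, sub_zero, div_one] at h
  linarith

variable {n : Type*} [Fintype n] {f : (n → ℝ) → ℝ} {gf : (n → ℝ) → n → ℝ}

theorem ConvexOn.gradient_monotone (hf : ConvexOn ℝ Set.univ f) (hd : Differentiable ℝ f)
    (hgrad : ∀ x v, fderiv ℝ f x v = gf x ⬝ᵥ v) (x y : n → ℝ) :
    0 ≤ (gf x - gf y) ⬝ᵥ (x - y) := by
  have h1 := hf.add_fderiv_sub_le (hd x) y
  have h2 := hf.add_fderiv_sub_le (hd y) x
  rw [hgrad, dotProduct_sub] at h1 h2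
  rw [sub_dotProduct, dotProduct_sub, dotProduct_sub]
  linarith

theorem ContDiff.continuous_gradient (hf : ContDiff ℝ 1 f)
    (hgrad : ∀ x v, fderiv ℝ f x v = gf x ⬝ᵥ v) : Continuous gf := by
  classical
  refine continuous_pi fun i => ?_
  have h : (fun x => gf x i) = fun x => fderiv ℝ f x (Pi.single i 1) := by
    ext x
    simp [hgrad]
  rw [h]
  exact (hf.continuous_fderiv one_ne_zero).clm_apply continuous_const

variable {m : Type*} [Fintype m] {A : Matrix m n ℝ}

/-- A saddle point of the Lagrangian `f x + l ⬝ᵥ A *ᵥ x` is a KKT point. -/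
theorem kkt_of_saddle (hd : Differentiable ℝ f) (hgrad : ∀ x v, fderiv ℝ f x v = gf x ⬝ᵥ v)
    {xs : n → ℝ} {ls : m → ℝ}
    (hs : ∀ (y : n → ℝ) (μ : m → ℝ),
      f xs + μ ⬝ᵥ (A *ᵥ xs) ≤ f xs + ls ⬝ᵥ (A *ᵥ xs) ∧
      f xs + ls ⬝ᵥ (A *ᵥ xs) ≤ f y + ls ⬝ᵥ (A *ᵥ y)) :
    A *ᵥ xs = 0 ∧ gf xs + Aᵀ *ᵥ ls = 0 := by
  constructor
  · have h := (hs xs (ls + A *ᵥ xs)).1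
    rw [add_dotProduct] at h
    have h0 : 0 ≤ (A *ᵥ xs) ⬝ᵥ (A *ᵥ xs) := by
      simpa using dotProduct_star_self_nonneg (A *ᵥ xs)
    exact dotProduct_self_eq_zero.mp (by linarith)
  · refine dotProduct_eq_zero _ fun v => ?_
    have hline : HasDerivAt (fun t : ℝ => xs + t • v) v 0 := by
      simpa using ((hasDerivAt_id (0 : ℝ)).smul_const v).const_add xs
    have hf' : HasFDerivAt f (fderiv ℝ f xs) (xs + (0 : ℝ) • v) := by
      simpa using (hd xs).hasFDerivAt
    have h1 := hf'.comp_hasDerivAt (0 : ℝ) hline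
    have h2 : HasDerivAt (fun t : ℝ => ls ⬝ᵥ A *ᵥ xs + t * (ls ⬝ᵥ A *ᵥ v)) (ls ⬝ᵥ A *ᵥ v) 0 := by
      simpa using ((hasDerivAt_id (0 : ℝ)).mul_const (ls ⬝ᵥ A *ᵥ v)).const_add (ls ⬝ᵥ A *ᵥ xs)
    have hmin : IsLocalMin ((f ∘ fun t : ℝ => xs + t • v) +
        fun t : ℝ => ls ⬝ᵥ A *ᵥ xs + t * (ls ⬝ᵥ A *ᵥ v)) 0 := by
      refine Eventually.of_forall fun t => ?_
      have h := (hs (xs + t • v) ls).2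
      simpa [mulVec_add, mulVec_smul] using h
    have h := hmin.hasDerivAt_eq_zero (h1.add h2)
    rwa [hgrad, dotProduct_mulVec, ← mulVec_transpose, ← add_dotProduct] at h

/-- A KKT point of a convex problem with linear constraints is optimal. -/
theorem ConvexOn.le_of_kkt (hf : ConvexOn ℝ Set.univ f) (hd : Differentiable ℝ f)
    (hgrad : ∀ x v, fderiv ℝ f x v = gf x ⬝ᵥ v) {xs : n → ℝ} {ls : m → ℝ}
    (hA : A *ᵥ xs = 0) (hg : gf xs + Aᵀ *ᵥ ls = 0) {y : n → ℝ} (hy : A *ᵥ y = 0) :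
    f xs ≤ f y := by
  have h := hf.add_fderiv_sub_le (hd xs) y
  rwa [hgrad, eq_neg_of_add_eq_zero_left hg, neg_dotProduct, mulVec_transpose,
    ← dotProduct_mulVec, mulVec_sub, hA, hy, sub_zero, dotProduct_zero, neg_zero, add_zero] at h

end Gradient

section Energy

variable {m n : Type*} [Fintype m] [Fintype n]

/-- The Lyapunov function of the ADMM iteration, in terms of the primal error `y`, the dual
error `w` and the diagonal `p` of the penalty matrix. -/
noncomputable def admmEnergy (Q : Matrix n n ℝ) (A : Matrix m n ℝ) (p : m → ℝ) (y : n → ℝ)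
    (w : m → ℝ) : ℝ :=
  y ⬝ᵥ Q *ᵥ y - ∑ i, p i * (A *ᵥ y) i ^ 2 + ∑ i, w i ^ 2 / p i

variable {Q : Matrix n n ℝ} {A : Matrix m n ℝ} {p p' : m → ℝ}

theorem dotProduct_sub_transpose_diagonal_mulVec [DecidableEq m] (y : n → ℝ) :
    y ⬝ᵥ (Q - Aᵀ * diagonal p * A) *ᵥ y = y ⬝ᵥ Q *ᵥ y - ∑ i, p i * (A *ᵥ y) i ^ 2 := by
  rw [sub_mulVec, dotProduct_sub, Matrix.mul_assoc, ← mulVec_mulVec, ← mulVec_mulVec,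
    dotProduct_mulVec y Aᵀ, vecMul_transpose]
  congr 1
  refine Finset.sum_congr rfl fun i _ => ?_
  rw [mulVec_diagonal]
  ring

theorem admmEnergy_step (hQ : Q.IsSymm) (hp : ∀ i, 0 < p i) (hpp' : ∀ i, p i ≤ p' i)
    {y y' : n → ℝ} {w w' : m → ℝ} (hw : ∀ i, w' i = w i + p' i * (A *ᵥ y') i)
    (hmono : ∑ i, (w i + p i * (A *ᵥ y) i) * (A *ᵥ y') i + y' ⬝ᵥ Q *ᵥ (y' - y) ≤ 0) :
    admmEnergy Q A p' y' w' + ((y' - y) ⬝ᵥ Q *ᵥ (y' - y) - ∑ i, p i * (A *ᵥ (y' - y)) i ^ 2)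
      + ∑ i, p i * (A *ᵥ y') i ^ 2 ≤ admmEnergy Q A p y w := by
  have hsum : ∑ i, (-(p' i * (A *ᵥ y') i ^ 2) + w' i ^ 2 / p' i - p i * (A *ᵥ (y' - y)) i ^ 2
        + p i * (A *ᵥ y') i ^ 2)
      ≤ ∑ i, (-(p i * (A *ᵥ y) i ^ 2) + w i ^ 2 / p i
        + 2 * ((w i + p i * (A *ᵥ y) i) * (A *ᵥ y') i)) := by
    refine Finset.sum_le_sum fun i _ => ?_
    have hp' : 0 < p' i := (hp i).trans_le (hpp' i)
    have h1 : w i ^ 2 / p' i ≤ w i ^ 2 / p i :=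
      div_le_div_of_nonneg_left (sq_nonneg _) (hp i) (hpp' i)
    have h2 : w' i ^ 2 / p' i
        = w i ^ 2 / p' i + 2 * w i * (A *ᵥ y') i + p' i * (A *ᵥ y') i ^ 2 := by
      rw [hw]
      field_simp
      ring
    rw [h2, mulVec_sub, Pi.sub_apply]
    linarith
  have hsymm : y ⬝ᵥ Q *ᵥ y' = y' ⬝ᵥ Q *ᵥ y := by
    rw [dotProduct_mulVec, ← mulVec_transpose, hQ.eq, dotProduct_comm]
  simp only [Finset.sum_add_distrib, Finset.sum_sub_distrib, Finset.sum_neg_distrib,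
    ← Finset.mul_sum] at hsum
  have hquad : (y' - y) ⬝ᵥ Q *ᵥ (y' - y)
      = y' ⬝ᵥ Q *ᵥ y' - 2 * (y' ⬝ᵥ Q *ᵥ y) + y ⬝ᵥ Q *ᵥ y := by
    rw [mulVec_sub, sub_dotProduct, dotProduct_sub, dotProduct_sub, hsymm]
    ring
  rw [mulVec_sub, dotProduct_sub] at hmono
  unfold admmEnergy
  linarith

theorem le_admmEnergy (hp : ∀ i, 0 < p i) (hpp' : ∀ i, p i ≤ p' i) (y : n → ℝ) (w : m → ℝ) :
    admmEnergy Q A p' y 0 + ∑ i, (p' i)⁻¹ * w i ^ 2 ≤ admmEnergy Q A p y w := by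
  have h1 : ∑ i, p i * (A *ᵥ y) i ^ 2 ≤ ∑ i, p' i * (A *ᵥ y) i ^ 2 :=
    Finset.sum_le_sum fun i _ => mul_le_mul_of_nonneg_right (hpp' i) (sq_nonneg _)
  have h2 : ∑ i, (p' i)⁻¹ * w i ^ 2 ≤ ∑ i, w i ^ 2 / p i :=
    Finset.sum_le_sum fun i _ => by
      rw [inv_mul_eq_div]
      exact div_le_div_of_nonneg_left (sq_nonneg _) (hp i) (hpp' i)
  simp only [admmEnergy, Pi.zero_apply, ne_eq, OfNat.ofNat_ne_zero, not_false_eq_true, zero_pow,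
    zero_div, Finset.sum_const_zero]
  linarith

theorem admmEnergy_le (hp : ∀ i, 0 < p i) (hpp' : ∀ i, p i ≤ p' i) (y : n → ℝ) (w : m → ℝ) :
    admmEnergy Q A p' y w ≤ y ⬝ᵥ Q *ᵥ y + ∑ i, w i ^ 2 / p i := by
  have h1 : 0 ≤ ∑ i, p' i * (A *ᵥ y) i ^ 2 :=
    Finset.sum_nonneg fun i _ => mul_nonneg ((hp i).le.trans (hpp' i)) (sq_nonneg _)
  have h2 : ∑ i, w i ^ 2 / p' i ≤ ∑ i, w i ^ 2 / p i :=
    Finset.sum_le_sum fun i _ => div_le_div_of_nonneg_left (sq_nonneg _) (hp i) (hpp' i)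
  unfold admmEnergy
  linarith

end Energy

section Convergence

theorem tendsto_zero_of_mul_norm_sq_le {V : Type*} [SeminormedAddCommGroup V] {u : ℕ → V}
    {b : ℕ → ℝ} {c : ℝ} (hc : 0 < c) (hu : ∀ k, c * ‖u k‖ ^ 2 ≤ b k)
    (hb : Tendsto b atTop (nhds 0)) : Tendsto u atTop (nhds 0) := by
  rw [tendsto_zero_iff_norm_tendsto_zero]
  have h : Tendsto (fun k => √(b k / c)) atTop (nhds 0) := by
    simpa using (hb.div_const c).sqrt
  refine squeeze_zero (fun _ => norm_nonneg _) (fun k => Real.le_sqrt_of_sq_le ?_) h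
  rw [le_div_iff₀ hc]
  linarith [hu k]

variable {m n : Type*} [Fintype m] [Fintype n]

theorem continuous_mulVec {k : Type*} (M : Matrix k n ℝ) :
    Continuous fun v : n → ℝ => M *ᵥ v := by
  fun_prop

/-- Convergence of the ADMM iteration with nondecreasing diagonal penalties `p k`, provided the
first-order optimality system is solvable. -/
theorem admm_tendsto_kkt [DecidableEq m] {gf : (n → ℝ) → n → ℝ} {Q : Matrix n n ℝ}
    {A : Matrix m n ℝ}
    (hcont : Continuous gf) (hmon : ∀ x y, 0 ≤ (gf x - gf y) ⬝ᵥ (x - y)) (hQ : Q.IsSymm)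
    {x : ℕ → n → ℝ} {l : ℕ → m → ℝ} {p : ℕ → m → ℝ} {pbar : m → ℝ}
    (hopt : ∀ k, gf (x (k + 1)) + Aᵀ *ᵥ (l k) + Aᵀ *ᵥ (diagonal (p k) *ᵥ (A *ᵥ x k))
      + Q *ᵥ (x (k + 1) - x k) = 0)
    (hlam : ∀ k, l (k + 1) = l k + diagonal (p (k + 1)) *ᵥ (A *ᵥ x (k + 1)))
    (hp : ∀ k i, 0 < p k i) (hmono : ∀ k i, p k i ≤ p (k + 1) i) (hpbar : ∀ k i, p k i ≤ pbar i)
    (hB : (Q - Aᵀ * diagonal pbar * A).PosDef)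
    (hkkt : ∃ xs ls, A *ᵥ xs = 0 ∧ gf xs + Aᵀ *ᵥ ls = 0) :
    ∃ xs ls, A *ᵥ xs = 0 ∧ gf xs + Aᵀ *ᵥ ls = 0 ∧ Tendsto x atTop (nhds xs) := by
  have hp0 : ∀ k i, p 0 i ≤ p k i := fun k i =>
    monotone_nat_of_le_succ (f := fun k => p k i) (fun k => hmono k i) (Nat.zero_le k)
  obtain ⟨c, hc, hcoer⟩ := exists_pos_mul_norm_sq_le_of_posDef hB
  obtain ⟨d, hd, hdual⟩ := exists_pos_mul_norm_sq_le_sum (d := fun i => (pbar i)⁻¹)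
    fun i => inv_pos.mpr ((hp 0 i).trans_le (hpbar 0 i))
  obtain ⟨e, he, hres⟩ := exists_pos_mul_norm_sq_le_sum (hp 0)
  have hlower : ∀ k (y : n → ℝ) (w : m → ℝ),
      c * ‖y‖ ^ 2 + d * ‖w‖ ^ 2 ≤ admmEnergy Q A (p k) y w := fun k y w => by
    have h1 := hcoer y
    rw [dotProduct_sub_transpose_diagonal_mulVec] at h1
    have h2 := le_admmEnergy (Q := Q) (A := A) (hp k) (hpbar k) y w
    simp only [admmEnergy, Pi.zero_apply, ne_eq, OfNat.ofNat_ne_zero, not_false_eq_true,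
      zero_pow, zero_div, Finset.sum_const_zero] at h2 ⊢
    linarith [hdual w]
  -- the energy decreases along the iteration, whatever the reference KKT point
  have hdecr : ∀ xs ls, A *ᵥ xs = 0 → gf xs + Aᵀ *ᵥ ls = 0 → ∀ k,
      admmEnergy Q A (p (k + 1)) (x (k + 1) - xs) (l (k + 1) - ls)
        + c * ‖x (k + 1) - x k‖ ^ 2 + e * ‖A *ᵥ x (k + 1)‖ ^ 2
      ≤ admmEnergy Q A (p k) (x k - xs) (l k - ls) := by
    intro xs ls hA hg k
    have hAsub : ∀ z, A *ᵥ (z - xs) = A *ᵥ z := fun z => by rw [mulVec_sub, hA, sub_zero]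
    have hinner : ∑ i, ((l k - ls) i + p k i * (A *ᵥ (x k - xs)) i) * (A *ᵥ (x (k + 1) - xs)) i
        + (x (k + 1) - xs) ⬝ᵥ Q *ᵥ (x (k + 1) - xs - (x k - xs)) ≤ 0 := by
      have h1 := hmon (x (k + 1)) xs
      have h2 : gf (x (k + 1)) - gf xs = -(Aᵀ *ᵥ ((l k - ls) + diagonal (p k) *ᵥ (A *ᵥ x k))
          + Q *ᵥ (x (k + 1) - x k)) := by
        rw [eq_neg_of_add_eq_zero_left hg, mulVec_add, mulVec_sub, ← sub_eq_zero, ← hopt k]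
        abel
      rw [h2, neg_dotProduct, add_dotProduct, mulVec_transpose, ← dotProduct_mulVec, hAsub] at h1
      rw [sub_sub_sub_cancel_right, hAsub, hAsub, dotProduct_comm (x (k + 1) - xs)]
      have h3 : ((l k - ls) + diagonal (p k) *ᵥ (A *ᵥ x k)) ⬝ᵥ (A *ᵥ x (k + 1))
          = ∑ i, ((l k - ls) i + p k i * (A *ᵥ x k) i) * (A *ᵥ x (k + 1)) i := by
        simp only [dotProduct, Pi.add_apply, mulVec_diagonal]
      linarith
    have hstep := admmEnergy_step (w' := l (k + 1) - ls) hQ (hp k) (hmono k) (fun i => by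
      rw [hlam k, hAsub, Pi.sub_apply, Pi.add_apply, mulVec_diagonal, Pi.sub_apply]; ring) hinner
    rw [sub_sub_sub_cancel_right, hAsub] at hstep
    have h1 := hlower k (x (k + 1) - x k) 0
    simp only [admmEnergy, norm_zero, Pi.zero_apply, ne_eq, OfNat.ofNat_ne_zero,
      not_false_eq_true, zero_pow, zero_div, Finset.sum_const_zero, mul_zero, add_zero] at h1
    have h2 : e * ‖A *ᵥ x (k + 1)‖ ^ 2 ≤ ∑ i, p k i * (A *ᵥ x (k + 1)) i ^ 2 :=
      (hres _).trans (Finset.sum_le_sum fun i _ =>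
        mul_le_mul_of_nonneg_right (hp0 k i) (sq_nonneg _))
    linarith
  have hanti : ∀ xs ls, A *ᵥ xs = 0 → gf xs + Aᵀ *ᵥ ls = 0 →
      Antitone fun k => admmEnergy Q A (p k) (x k - xs) (l k - ls) := fun xs ls hA hg =>
    antitone_nat_of_succ_le fun k => by
      have := hdecr xs ls hA hg k
      have h1 : 0 ≤ c * ‖x (k + 1) - x k‖ ^ 2 := by positivity
      have h2 : 0 ≤ e * ‖A *ᵥ x (k + 1)‖ ^ 2 := by positivity
      linarith
  obtain ⟨xs, ls, hA, hg⟩ := hkkt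
  set W : ℕ → ℝ := fun k => admmEnergy Q A (p k) (x k - xs) (l k - ls)
  have hWanti : Antitone W := hanti xs ls hA hg
  have hWlower : ∀ k, c * ‖x k - xs‖ ^ 2 + d * ‖l k - ls‖ ^ 2 ≤ W k := fun k => hlower k _ _
  have hgap : Tendsto (fun k => W k - W (k + 1)) atTop (nhds 0) := by
    have hlim := tendsto_atTop_ciInf hWanti ⟨0, by
      rintro _ ⟨k, rfl⟩
      exact le_trans (by positivity) (hWlower k)⟩
    simpa using hlim.sub (hlim.comp (tendsto_add_atTop_nat 1))
  have hdx : Tendsto (fun k => x (k + 1) - x k) atTop (nhds 0) :=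
    tendsto_zero_of_mul_norm_sq_le hc (fun k => by
      have h2 : 0 ≤ e * ‖A *ᵥ x (k + 1)‖ ^ 2 := by positivity
      linarith [hdecr xs ls hA hg k]) hgap
  have hAx : Tendsto (fun k => A *ᵥ x k) atTop (nhds 0) :=
    (tendsto_add_atTop_iff_nat 1).mp <| tendsto_zero_of_mul_norm_sq_le he (fun k => by
      have h1 : 0 ≤ c * ‖x (k + 1) - x k‖ ^ 2 := by positivity
      linarith [hdecr xs ls hA hg k]) hgap
  have hpAx : Tendsto (fun k => diagonal (p k) *ᵥ (A *ᵥ x k)) atTop (nhds 0) := by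
    rw [tendsto_pi_nhds] at hAx ⊢
    intro i
    refine squeeze_zero_norm (a := fun k => pbar i * ‖(A *ᵥ x k) i‖) (fun k => ?_)
      (by simpa using (hAx i).norm.const_mul (pbar i))
    rw [mulVec_diagonal, norm_mul, Real.norm_of_nonneg (hp k i).le]
    exact mul_le_mul_of_nonneg_right (hpbar k i) (norm_nonneg _)
  have hbdd : ∀ k, (x k, l k) ∈
      Metric.closedBall xs √(W 0 / c) ×ˢ Metric.closedBall ls √(W 0 / d) := fun k => by
    have h0 := (hWlower k).trans (hWanti (Nat.zero_le k))
    have h1 : 0 ≤ c * ‖x k - xs‖ ^ 2 := by positivity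
    have h2 : 0 ≤ d * ‖l k - ls‖ ^ 2 := by positivity
    rw [Set.mem_prod, mem_closedBall_iff_norm, mem_closedBall_iff_norm]
    constructor <;> refine Real.le_sqrt_of_sq_le ?_ <;>
      rw [le_div_iff₀ (by assumption)] <;> linarith
  obtain ⟨⟨xh, lh⟩, -, φ, hφ, hlim⟩ := tendsto_subseq_of_bounded
    (Metric.isBounded_closedBall.prod Metric.isBounded_closedBall) hbdd
  have hxφ : Tendsto (fun j => x (φ j)) atTop (nhds xh) := (continuous_fst.tendsto _).comp hlim
  have hlφ : Tendsto (fun j => l (φ j)) atTop (nhds lh) := (continuous_snd.tendsto _).comp hlim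
  have hxφ' : Tendsto (fun j => x (φ j + 1)) atTop (nhds xh) := by
    simpa using (hdx.comp hφ.tendsto_atTop).add hxφ
  have hAxh : A *ᵥ xh = 0 := tendsto_nhds_unique
    (((continuous_mulVec A).tendsto xh).comp hxφ) (hAx.comp hφ.tendsto_atTop)
  have hgxh : gf xh + Aᵀ *ᵥ lh = 0 := by
    have h := (((hcont.tendsto xh).comp hxφ').add (((continuous_mulVec Aᵀ).tendsto lh).comp hlφ)).add
      (((continuous_mulVec Aᵀ).tendsto 0).comp (hpAx.comp hφ.tendsto_atTop)) |>.add
      (((continuous_mulVec Q).tendsto 0).comp (hdx.comp hφ.tendsto_atTop))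
    simp only [mulVec_zero, add_zero] at h
    refine tendsto_nhds_unique h (tendsto_const_nhds.congr fun j => (hopt (φ j)).symm)
  refine ⟨xh, lh, hAxh, hgxh, ?_⟩
  have hsub : Tendsto (fun j => admmEnergy Q A (p (φ j)) (x (φ j) - xh) (l (φ j) - lh))
      atTop (nhds 0) := by
    have hU : Continuous fun z : (n → ℝ) × (m → ℝ) =>
        (z.1 - xh) ⬝ᵥ Q *ᵥ (z.1 - xh) + ∑ i, (z.2 i - lh i) ^ 2 / p 0 i := by fun_prop
    refine squeeze_zero (fun j => le_trans (by positivity) (hlower _ _ _))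
      (fun j => admmEnergy_le (hp 0) (hp0 _) _ _) ?_
    simpa [Function.comp_def] using (hU.tendsto (xh, lh)).comp hlim
  have hfull := (tendsto_iff_tendsto_subseq_of_antitone (hanti xh lh hAxh hgxh)
    hφ.tendsto_atTop).mpr hsub
  rw [← tendsto_sub_nhds_zero_iff]
  exact tendsto_zero_of_mul_norm_sq_le hc (fun k => by
    have h2 : 0 ≤ d * ‖l k - lh‖ ^ 2 := by positivity
    linarith [hlower k (x k - xh) (l k - lh)]) hfull

end Convergence

/-- Theorem 1 of the paper: under Conditions A and B and the existence of
a saddle point of the Lagrangian, the ADMM iterates converge to an optimal solution of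
the constrained problem `min f(x) s.t. A x = 0`. -/
theorem admm_convergence
    (N D E : ℕ) (hN : 0 < N) (hD : 0 < D) (hE : 0 < E)
    (f : (Fin (N * D) → ℝ) → ℝ) (gf : (Fin (N * D) → ℝ) → (Fin (N * D) → ℝ))
    (hconv : ConvexOn ℝ Set.univ f) (hsmooth : ContDiff ℝ 1 f)
    (hgrad : ∀ x v, fderiv ℝ f x v = gf x ⬝ᵥ v)
    (A : Matrix (Fin (E * D)) (Fin (N * D)) ℝ)
    (x : ℕ → (Fin (N * D) → ℝ)) (l : ℕ → (Fin (E * D) → ℝ))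
    (ρ : ℕ → Matrix (Fin (E * D)) (Fin (E * D)) ℝ)
    (ρbar : Matrix (Fin (E * D)) (Fin (E * D)) ℝ)
    (Q : Matrix (Fin (N * D)) (Fin (N * D)) ℝ) (hQ : Q.IsSymm)
    -- iterates
    (hopt : ∀ k, gf (x (k + 1)) + Aᵀ *ᵥ (l k) + Aᵀ *ᵥ (ρ k *ᵥ (A *ᵥ x k))
      + Q *ᵥ (x (k + 1) - x k) = 0)
    (hlam : ∀ k, l (k + 1) = l k + ρ (k + 1) *ᵥ (A *ᵥ x (k + 1)))
    -- Condition A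
    (hρdiag : ∀ k, (ρ k).IsDiag) (hρpos : ∀ k, (ρ k).PosDef)
    (hρbardiag : ρbar.IsDiag) (hρbarpos : ρbar.PosDef)
    (hρmono : ∀ k, (ρ (k + 1) - ρ k).PosSemidef)
    (hρ0 : ∀ k, (ρ k - ρ 0).PosSemidef)
    (hρbar : ∀ k, (ρbar - ρ k).PosSemidef)
    -- Condition B
    (hB : (Q - Aᵀ * ρbar * A).PosDef)
    -- existence of a saddle point of the Lagrangian
    (hsaddle : ∃ (xs : Fin (N * D) → ℝ) (ls : Fin (E * D) → ℝ),
      ∀ (y : Fin (N * D) → ℝ) (μ : Fin (E * D) → ℝ),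
        f xs + μ ⬝ᵥ (A *ᵥ xs) ≤ f xs + ls ⬝ᵥ (A *ᵥ xs) ∧
        f xs + ls ⬝ᵥ (A *ᵥ xs) ≤ f y + ls ⬝ᵥ (A *ᵥ y)) :
    ∃ xhat : Fin (N * D) → ℝ,
      A *ᵥ xhat = 0 ∧ (∀ y : Fin (N * D) → ℝ, A *ᵥ y = 0 → f xhat ≤ f y) ∧
      Tendsto x atTop (nhds xhat) := by
  have hd : Differentiable ℝ f := hsmooth.differentiable one_ne_zero
  have hdiag : ∀ k, diagonal (ρ k).diag = ρ k := fun k => (hρdiag k).diagonal_diag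
  obtain ⟨xs, ls, hs⟩ := hsaddle
  have hkkt := kkt_of_saddle hd hgrad hs
  obtain ⟨xh, lh, hA, hg, hlim⟩ := admm_tendsto_kkt (p := fun k => (ρ k).diag)
    (pbar := ρbar.diag) (hsmooth.continuous_gradient hgrad) (hconv.gradient_monotone hd hgrad) hQ
    (fun k => by simpa only [hdiag] using hopt k) (fun k => by simpa only [hdiag] using hlam k)
    (fun k i => (hρpos k).diag_pos) (fun k i => sub_nonneg.mp (hρmono k).diag_nonneg)
    (fun k i => sub_nonneg.mp (hρbar k).diag_nonneg)
    (by rwa [hρbardiag.diagonal_diag]) ⟨xs, ls, hkkt⟩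
  exact ⟨xh, hA, fun y hy => hconv.le_of_kkt hd hgrad hA hg hy, hlim⟩
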